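/- Let B ∈ ℝ^{L×K} and C ∈ ℝ^{L×N} with ℓ-th rows bℓᵀ and cℓᵀ, let (h♮,m♮) ∈ ℝ^K × ℝ^N, yℓ = (bℓᵀh♮)(cℓᵀm♮) and sℓ = sign(bℓᵀh♮) for ℓ = 1,…,L. If (h♮,m♮) is the unique minimizer of ‖h‖₂² + ‖m‖₂² over {(h,m) ∈ ℝ^K × ℝ^N : yℓ·((bℓᵀh)(cℓᵀm♮) + (bℓᵀh♮)(cℓᵀm)) ≥ 2yℓ² for all ℓ = 1,…,L}, then (h♮,m♮) is the unique minimizer of the BranchHull program (BH) with data (B, C, y, s). -/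

import Mathlib

/-- Feasibility for the BranchHull program with data `(B, C, y, s)`. -/
def BHFeas {L K N : ℕ} (B : Fin L → Fin K → ℝ) (C : Fin L → Fin N → ℝ)
    (y s : Fin L → ℝ) (h : EuclideanSpace ℝ (Fin K)) (m : EuclideanSpace ℝ (Fin N)) : Prop :=
  ∀ ℓ, Real.sign (y ℓ) * ((∑ i, B ℓ i * h i) * (∑ j, C ℓ j * m j)) ≥ |y ℓ| ∧
    s ℓ * (∑ i, B ℓ i * h i) ≥ 0

/-- Feasibility for the linearized program with constraints
`yℓ·((bℓᵀh)(cℓᵀm♮) + (bℓᵀh♮)(cℓᵀm)) ≥ 2yℓ²`. -/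
def LinFeas {L K N : ℕ} (B : Fin L → Fin K → ℝ) (C : Fin L → Fin N → ℝ)
    (y : Fin L → ℝ) (h₀ : EuclideanSpace ℝ (Fin K)) (m₀ : EuclideanSpace ℝ (Fin N))
    (h : EuclideanSpace ℝ (Fin K)) (m : EuclideanSpace ℝ (Fin N)) : Prop :=
  ∀ ℓ, y ℓ * ((∑ i, B ℓ i * h i) * (∑ j, C ℓ j * m₀ j) +
      (∑ i, B ℓ i * h₀ i) * (∑ j, C ℓ j * m j)) ≥ 2 * y ℓ ^ 2

theorem real_sign_mul_self (x : ℝ) : Real.sign x * x = |x| := by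
  rcases lt_trichotomy x 0 with h | rfl | h
  · simp [Real.sign_of_neg h, abs_of_neg h]
  · simp
  · simp [Real.sign_of_pos h, abs_of_pos h]

theorem real_sign_mul_abs (x : ℝ) : Real.sign x * |x| = x := by
  rcases lt_trichotomy x 0 with h | rfl | h
  · simp [Real.sign_of_neg h, abs_of_neg h]
  · simp
  · simp [Real.sign_of_pos h, abs_of_pos h]

/-- If `p * q` has the sign of `a * c` and at least its modulus, and `p` lies on the branch of `a`,
then `(p, q)` satisfies the linearization at `(a, c)` of the hyperbolic constraint. -/
theorem two_mul_sq_le_linearization {a c p q : ℝ}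
    (hpq : Real.sign (a * c) * (p * q) ≥ |a * c|) (hp : Real.sign a * p ≥ 0) :
    a * c * (p * c + a * q) ≥ 2 * (a * c) ^ 2 := by
  rcases eq_or_ne (a * c) 0 with h | hac
  · simp [h]
  have hprod : (a * c) ^ 2 ≤ a * c * (p * q) := by
    have := mul_le_mul_of_nonneg_left hpq (abs_nonneg (a * c))
    rwa [← mul_assoc, mul_comm |a * c| (Real.sign _), real_sign_mul_abs, abs_mul_abs_self, ← sq] at this
  have hap : 0 ≤ a * p := by
    have := mul_nonneg (abs_nonneg a) hp
    rwa [← mul_assoc, mul_comm |a| (Real.sign _), real_sign_mul_abs] at this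
  have hsq : 0 < (a * c) ^ 2 := by positivity
  have hcq : 0 ≤ c * q := by
    by_contra! hneg
    nlinarith [mul_nonneg hap (neg_nonneg.2 hneg.le)]
  have hsum : 0 ≤ a * c * (p * c + a * q) := by
    nlinarith [mul_nonneg hap (sq_nonneg c), mul_nonneg hcq (sq_nonneg a)]
  refine abs_le_of_sq_le_sq' ?_ hsum |>.2
  nlinarith [sq_nonneg (a * p * c ^ 2 - c * q * a ^ 2), mul_le_mul_of_nonneg_left hprod hsq.le]

/-- Every BranchHull-feasible point is feasible for the linearized program. -/
theorem BHFeas.linFeas {L K N : ℕ} {B : Fin L → Fin K → ℝ} {C : Fin L → Fin N → ℝ}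
    {y s : Fin L → ℝ} {h₀ h : EuclideanSpace ℝ (Fin K)} {m₀ m : EuclideanSpace ℝ (Fin N)}
    (hy : ∀ ℓ, y ℓ = (∑ i, B ℓ i * h₀ i) * (∑ j, C ℓ j * m₀ j))
    (hsgn : ∀ ℓ, s ℓ = Real.sign (∑ i, B ℓ i * h₀ i)) (hf : BHFeas B C y s h m) :
    LinFeas B C y h₀ m₀ h m := by
  intro ℓ
  obtain ⟨h₁, h₂⟩ := hf ℓ
  rw [hy] at h₁ ⊢
  rw [hsgn] at h₂
  exact two_mul_sq_le_linearization h₁ h₂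

/-- If `(h♮, m♮)` is the unique minimizer of the linearized program, then it is the
unique minimizer of the BranchHull program with `yℓ = (bℓᵀh♮)(cℓᵀm♮)`,
`sℓ = sign(bℓᵀh♮)`. -/
theorem stmt5 {L K N : ℕ} (B : Fin L → Fin K → ℝ) (C : Fin L → Fin N → ℝ)
    (h₀ : EuclideanSpace ℝ (Fin K)) (m₀ : EuclideanSpace ℝ (Fin N))
    (y s : Fin L → ℝ)
    (hy : ∀ ℓ, y ℓ = (∑ i, B ℓ i * h₀ i) * (∑ j, C ℓ j * m₀ j))
    (hsgn : ∀ ℓ, s ℓ = Real.sign (∑ i, B ℓ i * h₀ i))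
    (hmin : LinFeas B C y h₀ m₀ h₀ m₀ ∧
      ∀ h m, LinFeas B C y h₀ m₀ h m → (h, m) ≠ (h₀, m₀) →
        ‖h₀‖ ^ 2 + ‖m₀‖ ^ 2 < ‖h‖ ^ 2 + ‖m‖ ^ 2) :
    BHFeas B C y s h₀ m₀ ∧
      ∀ h m, BHFeas B C y s h m → (h, m) ≠ (h₀, m₀) →
        ‖h₀‖ ^ 2 + ‖m₀‖ ^ 2 < ‖h‖ ^ 2 + ‖m‖ ^ 2 := by
  refine ⟨fun ℓ => ⟨?_, ?_⟩, fun h m hf hne => hmin.2 h m (hf.linFeas hy hsgn) hne⟩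
  · rw [← hy, real_sign_mul_self]
  · rw [hsgn]
    exact Real.sign_mul_nonneg _
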